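/- arXiv:2506.13274 — 3 statements merged into one kernel-verified Lean document; each statement's English description precedes it below -/
import Mathlib

section
/- Let α and β be real numbers with α > 1 and β > 1 that are multiplicatively independent. Then for every positive rational number r and every ε > 0, there exist natural numbers m and n such that |α^m / β^n − r| < ε. -/
open Filter Topology

/-- One-sided Kronecker approximation: if `a / b` is irrational, then differences of natural
multiples of `a` and `b` approximate every real number. -/
theorem exists_nat_mul_sub_nat_mul_near {a b : ℝ} (ha : 0 < a) (hb : 0 < b)
    (hab : Irrational (a / b)) (t : ℝ) {δ : ℝ} (hδ : 0 < δ) :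
    ∃ m n : ℕ, |m * a - n * b - t| < δ := by
  have : Fact (0 < b) := ⟨hb⟩
  have hcluster : MapClusterPt (t : AddCircle b) atTop (· • (a : AddCircle b) : ℕ → AddCircle b) :=
    ((mapClusterPt_atTop_nsmul_tfae (t : AddCircle b) (a : AddCircle b)).out 0 3).2
      (AddCircle.denseRange_zsmul_coe_iff.2 hab _)
  have hnhds : ((↑) : ℝ → AddCircle b) '' Metric.ball t δ ∈ 𝓝 (t : AddCircle b) :=
    QuotientAddGroup.isOpenMap_coe.image_mem_nhds (Metric.ball_mem_nhds t hδ)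
  have hlarge : ∀ᶠ m : ℕ in atTop, t + δ ≤ m * a :=
    (tendsto_natCast_atTop_atTop.atTop_mul_const ha).eventually_ge_atTop _
  obtain ⟨m, ⟨x, hx, hxm⟩, hm⟩ := ((hcluster.frequently hnhds).and_eventually hlarge).exists
  rw [Metric.mem_ball, Real.dist_eq] at hx
  have hxm' : (x : AddCircle b) = ((m * a : ℝ) : AddCircle b) := by
    simpa [← nsmul_eq_mul] using hxm
  obtain ⟨k, hk⟩ := AddSubgroup.mem_zmultiples_iff.1 (QuotientAddGroup.eq.1 hxm')
  rw [zsmul_eq_mul] at hk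
  have hk0 : 0 ≤ k := by
    have hkb : 0 < (k : ℝ) * b := by linarith [(abs_lt.1 hx).2]
    exact_mod_cast (pos_of_mul_pos_left hkb hb.le).le
  lift k to ℕ using hk0
  refine ⟨m, k, ?_⟩
  rw [Int.cast_natCast] at hk
  rwa [hk, show m * a - (-x + m * a) - t = x - t by ring]

/-- The logarithms of multiplicatively independent reals have irrational ratio. -/
theorem irrational_log_div_log {α β : ℝ} (hα : 1 < α) (hβ : 1 < β)
    (hindep : ∀ m n : ℤ, α ^ m = β ^ n → m = 0 ∧ n = 0) :
    Irrational (Real.log α / Real.log β) := by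
  rintro ⟨q, hq⟩
  have hlogβ : Real.log β ≠ 0 := (Real.log_pos hβ).ne'
  have hden : (q.den : ℝ) ≠ 0 := by exact_mod_cast q.den_nz
  rw [Rat.cast_def, div_eq_div_iff hden hlogβ] at hq
  have hpow : α ^ (q.den : ℤ) = β ^ q.num := by
    apply Real.log_injOn_pos (Set.mem_Ioi.2 (by positivity)) (Set.mem_Ioi.2 (by positivity))
    rw [Real.log_zpow, Real.log_zpow, Int.cast_natCast]
    linarith
  exact q.den_nz (by exact_mod_cast (hindep _ _ hpow).1)

/-- Real numbers `α, β > 1` are multiplicatively independent if `α^m = β^n`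
for integers `m, n` implies `m = n = 0`. Then `{α^m / β^n : m n : ℕ}`
approximates every positive rational to arbitrary precision. -/
theorem adalrs_scaling_factors_approximate_rationals
    (α β : ℝ) (hα : 1 < α) (hβ : 1 < β)
    (hindep : ∀ m n : ℤ, α ^ m = β ^ n → m = 0 ∧ n = 0) :
    ∀ r : ℚ, 0 < r → ∀ ε : ℝ, 0 < ε →
      ∃ m n : ℕ, |α ^ m / β ^ n - (r : ℝ)| < ε := by
  intro r hr ε hε
  have hr' : (0 : ℝ) < r := by exact_mod_cast hr
  obtain ⟨δ, hδ, hexp⟩ :=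
    Metric.continuousAt_iff.1 (Real.continuous_exp.continuousAt (x := Real.log r)) ε hε
  obtain ⟨m, n, hmn⟩ := exists_nat_mul_sub_nat_mul_near (Real.log_pos hα) (Real.log_pos hβ)
    (irrational_log_div_log hα hβ hindep) (Real.log r) hδ
  refine ⟨m, n, ?_⟩
  have hclose := hexp (by rwa [Real.dist_eq])
  rwa [Real.dist_eq, Real.exp_log hr', Real.exp_sub, Real.exp_nat_mul, Real.exp_nat_mul,
    Real.exp_log (by positivity), Real.exp_log (by positivity)] at hclose
end

section
/- Let η* > 0, let α > 1 and β ∈ (0,1) be real numbers, let a be a real number with 0 < a and α·a < η*, and let b be a real number with β·b > η*. Set γ_a = (η* − α·a)/(η* − a), γ_b = (β·b − η*)/(b − η*), and γ = max(γ_a, γ_b). Then γ ∈ (0,1), and: (i) for every η with a ≤ η and α·η ≤ η*, one has η* − α·η ≤ γ·(η* − η), hence |α·η − η*| ≤ γ·|η − η*|; (ii) for every η with η ≤ b and β·η ≥ η*, one has β·η − η* ≤ γ·(η − η*), hence |β·η − η*| ≤ γ·|η − η*|. -/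
/-- Theorem 2 of the paper: geometric contraction of the learning-rate error
under up- and down-scaling adjustments. -/
theorem adalrs_geometric_contraction
    (ηs : ℝ) (hηs : 0 < ηs)
    (α : ℝ) (hα : 1 < α)
    (β : ℝ) (hβ : β ∈ Set.Ioo (0 : ℝ) 1)
    (a : ℝ) (ha : 0 < a) (haα : α * a < ηs)
    (b : ℝ) (hb : β * b > ηs)
    (γa γb γ : ℝ)
    (hγa : γa = (ηs - α * a) / (ηs - a))
    (hγb : γb = (β * b - ηs) / (b - ηs))
    (hγ : γ = max γa γb) :
    γ ∈ Set.Ioo (0 : ℝ) 1 ∧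
    (∀ η : ℝ, a ≤ η → α * η ≤ ηs →
      ηs - α * η ≤ γ * (ηs - η) ∧ |α * η - ηs| ≤ γ * |η - ηs|) ∧
    (∀ η : ℝ, η ≤ b → β * η ≥ ηs →
      β * η - ηs ≤ γ * (η - ηs) ∧ |β * η - ηs| ≤ γ * |η - ηs|) := by
  obtain ⟨hβ0, hβ1⟩ := hβ
  have hb0 : 0 < b := pos_of_mul_pos_right (hηs.trans hb) hβ0.le
  have hda : 0 < ηs - a := by nlinarith
  have hdb : 0 < b - ηs := by nlinarith
  have hγa0 : 0 < γa := hγa ▸ div_pos (sub_pos.2 haα) hda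
  have hγa1 : γa < 1 := by
    rw [hγa, div_lt_one hda]
    nlinarith
  have hγb1 : γb < 1 := by
    rw [hγb, div_lt_one hdb]
    nlinarith
  have hγaγ : γa ≤ γ := hγ ▸ le_max_left _ _
  have hγbγ : γb ≤ γ := hγ ▸ le_max_right _ _
  refine ⟨⟨hγa0.trans_le hγaγ, hγ ▸ max_lt hγa1 hγb1⟩, fun η hη hαη => ?_, fun η hη hβη => ?_⟩
  · have hlt : η < ηs := by nlinarith
    have key : ηs - α * η ≤ γ * (ηs - η) := by
      refine le_trans ?_ (mul_le_mul_of_nonneg_right hγaγ (sub_pos.2 hlt).le)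
      rw [hγa, div_mul_eq_mul_div, le_div_iff₀ hda]
      nlinarith [mul_nonneg hηs.le (mul_nonneg (sub_pos.2 hα).le (sub_nonneg.2 hη))]
    refine ⟨key, ?_⟩
    rwa [abs_sub_comm, abs_of_nonneg (sub_nonneg.2 hαη), abs_sub_comm,
      abs_of_pos (sub_pos.2 hlt)]
  · have hη0 : 0 < η := pos_of_mul_pos_right (hηs.trans_le hβη) hβ0.le
    have hlt : ηs < η := by nlinarith
    have key : β * η - ηs ≤ γ * (η - ηs) := by
      refine le_trans ?_ (mul_le_mul_of_nonneg_right hγbγ (sub_pos.2 hlt).le)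
      rw [hγb, div_mul_eq_mul_div, le_div_iff₀ hdb]
      nlinarith [mul_nonneg hηs.le (mul_nonneg (sub_pos.2 hβ1).le (sub_nonneg.2 hη))]
    refine ⟨key, ?_⟩
    rwa [abs_of_nonneg (sub_nonneg.2 hβη), abs_of_pos (sub_pos.2 hlt)]
end

section
/- Let η* > 0, let V : ℝ → ℝ be strictly increasing on the interval (0, η*] and strictly decreasing on the interval [η*, ∞), let α > 1 and β ∈ (0,1) be real numbers, and let a ∈ (1, α] and b ∈ [β, 1) be real numbers. Let η be a real number with β·η*/α < η < α·η*, and let η' be a real number satisfying: η' = a·η if V(a·η) > V(η); η' = b·η if V(a·η) < V(η); and η' = η if V(a·η) = V(η). Then β·η*/α < η' < α·η*. -/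
/-- Invariance underlying Proposition 2: the learning rate remains trapped in the
multiplicative neighborhood `(β·η*/α, α·η*)` of the optimum under AdaLRS steps. -/
theorem adalrs_learning_rate_invariant_region
    (ηs : ℝ) (hηs : 0 < ηs) (V : ℝ → ℝ)
    (hmono : StrictMonoOn V (Set.Ioc 0 ηs))
    (hanti : StrictAntiOn V (Set.Ici ηs))
    (α : ℝ) (hα : 1 < α) (β : ℝ) (hβ : β ∈ Set.Ioo (0 : ℝ) 1)
    (a : ℝ) (ha : a ∈ Set.Ioc 1 α) (b : ℝ) (hb : b ∈ Set.Ico β 1)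
    (η : ℝ) (hη₁ : β * ηs / α < η) (hη₂ : η < α * ηs)
    (η' : ℝ)
    (hup : V (a * η) > V η → η' = a * η)
    (hdown : V (a * η) < V η → η' = b * η)
    (hkeep : V (a * η) = V η → η' = η) :
    β * ηs / α < η' ∧ η' < α * ηs := by
  obtain ⟨hβ0, hβ1⟩ := hβ
  obtain ⟨ha1, haα⟩ := ha
  obtain ⟨hbβ, hb1⟩ := hb
  have hα0 : 0 < α := by linarith
  have hη0 : 0 < η := lt_trans (by positivity) hη₁
  have hlt : η < a * η := lt_mul_of_one_lt_left hη0 ha1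
  rcases lt_trichotomy (V (a * η)) (V η) with h | h | h
  · have hover : ηs < a * η := by
      by_contra! hle
      exact lt_asymm h (hmono ⟨hη0, hlt.le.trans hle⟩ ⟨hη0.trans hlt, hle⟩ hlt)
    rw [hdown h]
    constructor
    · rw [div_lt_iff₀ hα0]
      calc β * ηs < β * (a * η) := by gcongr
        _ ≤ b * (α * η) := by gcongr; linarith
        _ = b * η * α := by ring
    · exact (mul_lt_of_lt_one_left hη0 hb1).trans hη₂
  · rw [hkeep h]
    exact ⟨hη₁, hη₂⟩
  · have hunder : η < ηs := by
      by_contra! hle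
      exact lt_asymm h (hanti hle (hle.trans hlt.le) hlt)
    rw [hup h]
    refine ⟨hη₁.trans hlt, ?_⟩
    calc a * η < a * ηs := by gcongr
      _ ≤ α * ηs := by gcongr
end
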